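/- arXiv:1902.00444 — 3 statements merged into one kernel-verified Lean document; each statement's English description precedes it below -/
import Mathlib

section
/- Let E(λ)=A+λB be an n×n ⊤-palindromic matrix pencil over ℂ (i.e., A^T=B) whose rank equals r (r ≤ n), and set s=⌊r/2⌋. Then there exist vectors v_1,…,v_s ∈ ℂ^n, vector pencils w_1,…,w_s of degree at most one, and (if r is odd) a vector u ∈ ℂ^n, such that A+λB = Σ_{j=1}^{s} ( v_j w_j(λ)^T + (rev w_j)(λ) v_j^T ) if r is even, and A+λB = (1+λ) u u^T + Σ_{j=1}^{s} ( v_j w_j(λ)^T + (rev w_j)(λ) v_j^T ) if r is odd. -/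
open Matrix BigOperators

/-- The rank of the pencil `A + λ B` (the maximum over `μ ∈ ℂ` of the rank of
`A + μ B`) equals `r`. -/
def PencilRankEq (n : ℕ) (A B : Matrix (Fin n) (Fin n) ℂ) (r : ℕ) : Prop :=
  (∃ μ : ℂ, (A + μ • B).rank = r) ∧ ∀ μ : ℂ, (A + μ • B).rank ≤ r

universe u v

section Forms

open Module Filter LinearMap

variable {K : Type u} [Field K] {V : Type v} [AddCommGroup V] [Module K V]

/-- For all but finitely many `μ`, the bilinear form `B + μ Bᵀ` has rank at most `k`. -/
def GenericRankLE (B : V →ₗ[K] V →ₗ[K] K) (k : ℕ) : Prop :=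
  ∀ᶠ μ : K in cofinite, finrank K (range (B + μ • B.flip)) ≤ k

/-- The bilinear form `B` vanishes identically on the subspace `W`. -/
def VanishesOn (B : V →ₗ[K] V →ₗ[K] K) (W : Submodule K V) : Prop :=
  ∀ x ∈ W, ∀ y ∈ W, B x y = 0

theorem eventually_add_mul_ne_zero {a b : K} (h : a ≠ 0 ∨ b ≠ 0) :
    ∀ᶠ μ : K in cofinite, a + μ * b ≠ 0 := by
  by_cases hb : b = 0
  · simp_all
  · filter_upwards [(Set.finite_singleton (-a / b)).eventually_cofinite_notMem] with μ hμ h0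
    apply hμ
    rw [Set.mem_singleton_iff, eq_div_iff hb]
    linear_combination h0

variable [FiniteDimensional K V]

/-- An antisymmetric form on an odd-dimensional space is degenerate. -/
theorem exists_ne_zero_of_antisymm_of_odd [NeZero (2 : K)] (D : V →ₗ[K] V →ₗ[K] K)
    (hD : ∀ x y, D y x = -D x y) (hodd : Odd (finrank K V)) :
    ∃ x ≠ 0, ∀ y, D x y = 0 := by
  by_contra! hcon
  have hsep : D.SeparatingLeft := fun x hx => by
    by_contra hne
    obtain ⟨y, hy⟩ := hcon x hne
    exact hy (hx y)
  let b := finBasis K V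
  rw [LinearMap.separatingLeft_iff_det_ne_zero b] at hsep
  have htr : (LinearMap.toMatrix₂ b b D).transpose = -LinearMap.toMatrix₂ b b D := by
    ext i j
    simp [LinearMap.toMatrix₂_apply, hD (b i) (b j)]
  have hdet := congrArg Matrix.det htr
  rw [Matrix.det_transpose, Matrix.det_neg, Fintype.card_fin, hodd.neg_one_pow] at hdet
  apply hsep
  have h2 : (2 : K) * (LinearMap.toMatrix₂ b b D).det = 0 := by linear_combination hdet
  exact (mul_eq_zero.mp h2).resolve_left (NeZero.ne _)

theorem finrank_range_domRestrict_le (M : V →ₗ[K] V →ₗ[K] K) (C : Submodule K V) :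
    finrank K (range (M.domRestrict₁₂ C C)) ≤ finrank K (range M) := by
  let R : (V →ₗ[K] K) →ₗ[K] (C →ₗ[K] K) := LinearMap.lcomp K K C.subtype
  refine (Submodule.finrank_mono ?_).trans (Submodule.finrank_map_le R (range M))
  rintro _ ⟨c, rfl⟩
  exact ⟨M c, ⟨c, rfl⟩, rfl⟩

theorem finrank_map_lt_of_mem_ker {V' : Type*} [AddCommGroup V'] [Module K V']
    (R : V →ₗ[K] V') {U : Submodule K V} {x : V} (hxU : x ∈ U) (hx : x ≠ 0) (hRx : R x = 0) :
    finrank K (U.map R) < finrank K U := by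
  have hker : 0 < finrank K (ker (R.domRestrict U)) := by
    rw [finrank_pos_iff_exists_ne_zero]
    exact ⟨⟨⟨x, hxU⟩, hRx⟩, fun h => hx (congrArg (fun t => (t : U).1) (congrArg Subtype.val h))⟩
  have h := (R.domRestrict U).finrank_range_add_finrank_ker
  rw [LinearMap.range_domRestrict] at h
  lia

/-- Restricting a form to a subspace orthogonal to `x` lowers the rank by two, if `x` lies in
neither the left nor the right radical. -/
theorem finrank_range_domRestrict_add_two_le (M : V →ₗ[K] V →ₗ[K] K) {H C : Submodule K V}
    (hCH : C ≤ H) {x z : V} (hx : x ∈ H) (hMx : M x ≠ 0) (hz : M z x ≠ 0)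
    (hl : ∀ y ∈ H, M x y = 0) (hr : ∀ y ∈ H, M y x = 0) :
    finrank K (range (M.domRestrict₁₂ C C)) + 2 ≤ finrank K (range M) := by
  let R : (V →ₗ[K] K) →ₗ[K] (C →ₗ[K] K) := LinearMap.lcomp K K C.subtype
  let U : Submodule K (V →ₗ[K] K) := H.map M
  have hU : finrank K U < finrank K (range M) := by
    refine Submodule.finrank_lt_finrank_of_lt (lt_of_le_of_ne LinearMap.map_le_range ?_)
    intro h
    have hmem : M z ∈ U := h ▸ LinearMap.mem_range_self M z
    obtain ⟨y, hy, hyz⟩ := hmem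
    exact hz (by rw [← hyz, hr y hy])
  have hR : finrank K (U.map R) < finrank K U :=
    finrank_map_lt_of_mem_ker R ⟨x, hx, rfl⟩ hMx (LinearMap.ext fun c => hl c (hCH c.2))
  have hrange : finrank K (range (M.domRestrict₁₂ C C)) ≤ finrank K (U.map R) := by
    refine Submodule.finrank_mono ?_
    rintro _ ⟨c, rfl⟩
    exact ⟨M c, ⟨c, hCH c.2, rfl⟩, rfl⟩
  lia

theorem finrank_le_finrank_inf_ker_add_one (U : Submodule K V) (f : V →ₗ[K] K) :
    finrank K U ≤ finrank K (U ⊓ ker f : Submodule K V) + 1 := by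
  have h1 := (f.domRestrict U).finrank_range_add_finrank_ker
  have h2 : finrank K (range (f.domRestrict U)) ≤ 1 := by
    simpa using Submodule.finrank_le (range (f.domRestrict U))
  have h3 : finrank K (ker (f.domRestrict U)) = finrank K (U ⊓ ker f : Submodule K V) := by
    rw [← Submodule.finrank_map_subtype_eq]
    suffices h : (ker (f.domRestrict U)).map U.subtype = U ⊓ ker f by rw [h]
    rw [LinearMap.ker_domRestrict, Submodule.map_comap_subtype]
  lia

/-- Adjoining to an isotropic subspace an isotropic vector orthogonal to it. -/
theorem VanishesOn.sup_span_singleton {B : V →ₗ[K] V →ₗ[K] K} {W : Submodule K V}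
    (hW : VanishesOn B W) {x : V} (hx : B x x = 0) (hl : ∀ y ∈ W, B x y = 0)
    (hr : ∀ y ∈ W, B y x = 0) (hxW : x ∉ W) :
    ∃ W' : Submodule K V, VanishesOn B W' ∧ finrank K W + 1 ≤ finrank K W' := by
  refine ⟨W ⊔ K ∙ x, ?_, ?_⟩
  · intro y' hy' z' hz'
    obtain ⟨y, hy, _, ha, rfl⟩ := Submodule.mem_sup.mp hy'
    obtain ⟨r, rfl⟩ := Submodule.mem_span_singleton.mp ha
    obtain ⟨z, hz, _, hb, rfl⟩ := Submodule.mem_sup.mp hz'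
    obtain ⟨t, rfl⟩ := Submodule.mem_span_singleton.mp hb
    simp [hW y hy z hz, hl z hz, hr y hy, hx]
  · refine Submodule.finrank_lt_finrank_of_lt (lt_of_le_of_ne le_sup_left fun h => hxW ?_)
    rw [h]
    exact Submodule.mem_sup_right (Submodule.mem_span_singleton_self x)

/-- The inductive step: an isotropic vector `x` spanning an eigenline of the pencil allows passing
to a proper subspace orthogonal to `x` and complementary to it. -/
theorem exists_vanishesOn_of_eigenvector [Infinite K] {B : V →ₗ[K] V →ₗ[K] K} {s : ℕ}
    (hB : GenericRankLE B (2 * s))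
    (ih : ∀ C : Submodule K V, C < ⊤ → ∀ t, GenericRankLE (B.domRestrict₁₂ C C) (2 * t) →
      ∃ W ≤ C, VanishesOn B W ∧ finrank K C ≤ finrank K W + t)
    {x : V} (hx : x ≠ 0) (hxx : B x x = 0) {α β : K} (hαβ : α ≠ 0 ∨ β ≠ 0)
    (heig : ∀ y, α * B x y + β * B y x = 0) :
    ∃ W : Submodule K V, VanishesOn B W ∧ finrank K V ≤ finrank K W + s := by
  obtain ⟨ψ, hψ⟩ := Projective.exists_dual_eq_one K hx
  by_cases hrad : B x = 0 ∧ B.flip x = 0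
  · have hlt : ker ψ < ⊤ := lt_top_iff_ne_top.mpr fun h => by
      have hmem : x ∈ ker ψ := h ▸ Submodule.mem_top
      simp [hψ] at hmem
    obtain ⟨W, hWC, hW, hdim⟩ := ih (ker ψ) hlt s
      (hB.mono fun μ hμ => (finrank_range_domRestrict_le (B + μ • B.flip) (ker ψ)).trans hμ)
    obtain ⟨W', hW', hdim'⟩ := hW.sup_span_singleton hxx
      (fun y _ => by simp [hrad.1])
      (fun y _ => by simpa using LinearMap.congr_fun hrad.2 y)
      (fun h => by simpa [hψ] using hWC h)
    refine ⟨W', hW', ?_⟩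
    have h := finrank_le_finrank_inf_ker_add_one ⊤ ψ
    rw [finrank_top, top_inf_eq] at h
    lia
  · obtain ⟨φ, a, b, hφ, hab, ha, hb⟩ : ∃ (φ : V →ₗ[K] K) (a b : K), φ ≠ 0 ∧ (a ≠ 0 ∨ b ≠ 0) ∧
        (∀ y, B x y = a * φ y) ∧ ∀ y, B y x = b * φ y := by
      by_cases hβ : β = 0
      · have hα : α ≠ 0 := hαβ.resolve_right (not_not.mpr hβ)
        have hBx : B x = 0 := LinearMap.ext fun y => by simpa [hβ, hα] using heig y
        exact ⟨B.flip x, 0, 1, fun h => hrad ⟨hBx, h⟩, by simp, by simp [hBx], by simp⟩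
      · have hfl : ∀ y, B y x = -α / β * B x y := fun y => by
          field_simp
          linear_combination heig y
        refine ⟨B x, 1, -α / β, fun h => hrad ⟨h, LinearMap.ext fun y => ?_⟩, by simp, by simp, hfl⟩
        simp [hfl y, h]
    have hφx : φ x = 0 := by
      rcases hab with h | h
      · simpa [h, hxx] using ha x
      · simpa [h, hxx] using hb x
    obtain ⟨z, hz⟩ : ∃ z, φ z ≠ 0 := by
      by_contra! h
      exact hφ (LinearMap.ext h)
    have hlt : ker φ ⊓ ker ψ < ⊤ := lt_top_iff_ne_top.mpr fun h => by
      have hmem : x ∈ ker φ ⊓ ker ψ := h ▸ Submodule.mem_top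
      simp [hψ] at hmem
    have hdrop : ∀ᶠ μ : K in cofinite, finrank K (range (B.domRestrict₁₂ (ker φ ⊓ ker ψ)
        (ker φ ⊓ ker ψ) + μ • (B.domRestrict₁₂ (ker φ ⊓ ker ψ) (ker φ ⊓ ker ψ)).flip)) + 2
          ≤ 2 * s := by
      filter_upwards [hB, eventually_add_mul_ne_zero hab, eventually_add_mul_ne_zero hab.symm]
        with μ hμ h1 h2
      refine le_trans (finrank_range_domRestrict_add_two_le (B + μ • B.flip) (H := ker φ) (x := x)
        (z := z) inf_le_left hφx (fun h => ?_) ?_ (fun y hy => ?_) (fun y hy => ?_)) hμ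
      · have h' : (a + μ * b) * φ z = 0 := by
          have := LinearMap.congr_fun h z
          simp only [LinearMap.add_apply, LinearMap.smul_apply, LinearMap.flip_apply, ha, hb,
            smul_eq_mul, LinearMap.zero_apply] at this
          linear_combination this
        exact mul_ne_zero h1 hz h'
      · have h' : (B + μ • B.flip) z x = (b + μ * a) * φ z := by
          simp only [LinearMap.add_apply, LinearMap.smul_apply, LinearMap.flip_apply, ha, hb,
            smul_eq_mul]
          ring
        rw [h']
        exact mul_ne_zero h2 hz
      · simp [ha, hb, LinearMap.mem_ker.mp hy]
      · simp [ha, hb, LinearMap.mem_ker.mp hy]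
    obtain ⟨μ, hμ⟩ := hdrop.exists
    obtain ⟨W, hWC, hW, hdim⟩ := ih _ hlt (s - 1) (hdrop.mono fun μ hμ => by lia)
    obtain ⟨W', hW', hdim'⟩ := hW.sup_span_singleton hxx
      (fun y hy => by simp [ha, LinearMap.mem_ker.mp (hWC hy).1])
      (fun y hy => by simp [hb, LinearMap.mem_ker.mp (hWC hy).1])
      (fun h => by simpa [hψ] using (hWC h).2)
    refine ⟨W', hW', ?_⟩
    have h1 := finrank_le_finrank_inf_ker_add_one ⊤ φ
    have h2 := finrank_le_finrank_inf_ker_add_one (ker φ) ψ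
    rw [finrank_top, top_inf_eq] at h1
    lia

/-- In even dimension, if the radical of `B - Bᵀ` is nonzero, then it contains a nonzero isotropic
vector of `B`. -/
theorem exists_isotropic_of_symmetric_vector [IsAlgClosed K] [NeZero (2 : K)]
    {B : V →ₗ[K] V →ₗ[K] K} (heven : Even (finrank K V)) {x : V} (hx : x ≠ 0)
    (hsymm : ∀ y, B x y = B y x) :
    ∃ x ≠ 0, B x x = 0 ∧ ∀ y, B x y = B y x := by
  by_cases hxx : B x x = 0
  · exact ⟨x, hx, hxx, hsymm⟩
  have hφ : B x ≠ 0 := fun h => hxx (by simp [h])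
  have hodd : Odd (finrank K (ker (B x))) := by
    have := Module.Dual.finrank_ker_add_one_of_ne_zero hφ
    rw [← this] at heven
    simpa [Nat.even_add_one] using heven
  obtain ⟨⟨y, hy⟩, hy0, hyK⟩ := exists_ne_zero_of_antisymm_of_odd
    ((B - B.flip).domRestrict₁₂ (ker (B x)) (ker (B x))) (fun _ _ => (neg_sub _ _).symm) hodd
  have hxy : B x y = 0 := hy
  have hysymm : ∀ z, B y z = B z y := fun z => by
    have hmem : z - (B x z / B x x) • x ∈ ker (B x) := by simp [hxx]
    have h := hyK ⟨_, hmem⟩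
    simp only [LinearMap.domRestrict₁₂_apply, LinearMap.sub_apply, LinearMap.flip_apply, map_sub,
      map_smul, ← hsymm y, hxy] at h
    simpa [sub_eq_zero] using h
  by_cases hyy : B y y = 0
  · exact ⟨y, fun h => hy0 (Subtype.ext h), hyy, hysymm⟩
  obtain ⟨t, ht⟩ := IsAlgClosed.exists_pow_nat_eq (-B x x / B y y) zero_lt_two
  refine ⟨x + t • y, fun h => hxx ?_, ?_, fun z => by simp [hsymm z, hysymm z]⟩
  · simpa [hxy] using congrArg (B x) h
  · have ht' : t ^ 2 * B y y = -B x x := by rw [ht]; field_simp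
    simp only [map_add, map_smul, LinearMap.add_apply, LinearMap.smul_apply, ← hsymm y, hxy,
      smul_eq_mul]
    linear_combination ht'

/-- A form whose pencil has generic rank at most `2 s` vanishes on a subspace of codimension at
most `s`. -/
theorem exists_vanishesOn [IsAlgClosed K] [NeZero (2 : K)] {B : V →ₗ[K] V →ₗ[K] K} {s : ℕ}
    (hB : GenericRankLE B (2 * s)) :
    ∃ W : Submodule K V, VanishesOn B W ∧ finrank K V ≤ finrank K W + s := by
  induction hn : finrank K V using Nat.strong_induction_on generalizing V s with
  | _ n IH =>
  subst hn
  have ih : ∀ C : Submodule K V, C < ⊤ → ∀ t, GenericRankLE (B.domRestrict₁₂ C C) (2 * t) →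
      ∃ W ≤ C, VanishesOn B W ∧ finrank K C ≤ finrank K W + t := by
    intro C hC t ht
    obtain ⟨W, hW, hdim⟩ := IH _ (Submodule.finrank_lt hC.ne) ht rfl
    refine ⟨W.map C.subtype, Submodule.map_subtype_le C W, ?_, ?_⟩
    · rintro _ ⟨x, hx, rfl⟩ _ ⟨y, hy, rfl⟩
      exact hW x hx y hy
    · rwa [Submodule.finrank_map_subtype_eq]
  rcases subsingleton_or_nontrivial V with hV | hV
  · exact ⟨⊤, fun x _ y _ => by simp [Subsingleton.elim x 0], by simp⟩
  by_cases hsing : ∃ (α β : K) (x : V), α + β ≠ 0 ∧ x ≠ 0 ∧ ∀ y, α * B x y + β * B y x = 0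
  · obtain ⟨α, β, x, hαβ, hx, heig⟩ := hsing
    refine exists_vanishesOn_of_eigenvector hB ih hx ?_ ?_ heig
    · have h : (α + β) * B x x = 0 := by linear_combination heig x
      exact (mul_eq_zero.mp h).resolve_left hαβ
    · by_contra! h
      simp [h] at hαβ
  have hinj : ∀ μ : K, 1 + μ * 1 ≠ 0 → Function.Injective (B + μ • B.flip) := fun μ hμ => by
    rw [injective_iff_map_eq_zero]
    intro x hx
    by_contra hx0
    exact hsing ⟨1, μ, x, by simpa using hμ, hx0, fun y => by
      simpa using LinearMap.congr_fun hx y⟩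
  have hdim : finrank K V ≤ 2 * s := by
    obtain ⟨μ, hμ, h1⟩ := (hB.and (eventually_add_mul_ne_zero (a := 1) (b := 1) (by simp))).exists
    rwa [LinearMap.finrank_range_of_inj (hinj μ h1)] at hμ
  obtain ⟨x₀, hx₀⟩ := exists_ne (0 : V)
  rcases Nat.even_or_odd (finrank K V) with heven | hodd
  · have hBinj : Function.Injective B := by simpa using hinj 0 (by simp)
    let e : V ≃ₗ[K] Module.Dual K V :=
      LinearEquiv.ofInjectiveOfFinrankEq B hBinj Subspace.dual_finrank_eq.symm
    obtain ⟨ν, hν⟩ := Module.End.exists_eigenvalue (e.symm.toLinearMap ∘ₗ B.flip)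
    obtain ⟨x, hx⟩ := hν.exists_hasEigenvector
    have hx' : ∀ y, B y x = ν * B x y := fun y => by
      have h : B.flip x = e (ν • x) := by simpa using congrArg e hx.apply_eq_smul
      have he : e (ν • x) = B (ν • x) := rfl
      rw [he] at h
      simpa using LinearMap.congr_fun h y
    have hν1 : ν = 1 := by
      by_contra hne
      exact hsing ⟨ν, -1, x, fun h => hne (by linear_combination h), hx.2, fun y => by
        rw [hx' y]; ring⟩
    obtain ⟨y, hy, hyy, hsymm⟩ := exists_isotropic_of_symmetric_vector heven hx.2
      (fun y => by rw [hx' y, hν1, one_mul])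
    exact exists_vanishesOn_of_eigenvector hB ih hy hyy (α := 1) (β := -1) (by simp)
      (fun z => by rw [hsymm z]; ring)
  · obtain ⟨ψ, hψ⟩ := Projective.exists_dual_eq_one K hx₀
    have hψ0 : ψ ≠ 0 := fun h => by simp [h] at hψ
    have hker := Module.Dual.finrank_ker_add_one_of_ne_zero hψ0
    have hlt : ker ψ < ⊤ := lt_top_iff_ne_top.mpr fun h => hψ0 (LinearMap.ker_eq_top.mp h)
    obtain ⟨k, hk⟩ := hodd
    obtain ⟨W, -, hW, hW'⟩ := ih (ker ψ) hlt (s - 1) (Eventually.of_forall fun μ =>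
      (LinearMap.finrank_range_le _).trans (by lia))
    exact ⟨W, hW, by lia⟩

/-- A form vanishing on a subspace of codimension at most `s` is a sum of `s` pairs of products of
functionals. -/
theorem VanishesOn.exists_eq_sum {B : V →ₗ[K] V →ₗ[K] K} {W : Submodule K V} (hW : VanishesOn B W)
    {s : ℕ} (hs : finrank K V ≤ finrank K W + s) :
    ∃ f g h : Fin s → V →ₗ[K] K, ∀ x y, B x y = ∑ j, (f j x * g j y + h j x * f j y) := by
  obtain ⟨C, hC⟩ := W.exists_isCompl
  have hCs : finrank K C ≤ finrank K (Fin s → K) := by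
    have := Submodule.finrank_add_eq_of_isCompl hC
    rw [finrank_fin_fun]
    lia
  obtain ⟨i, hi⟩ : ∃ i : C →ₗ[K] (Fin s → K), Function.Injective i := by
    rw [← lift_rank_le_iff_exists_linearMap, ← finrank_eq_rank, ← finrank_eq_rank]
    rw [Cardinal.lift_natCast, Cardinal.lift_natCast]
    exact_mod_cast hCs
  obtain ⟨p, hp⟩ := i.exists_leftInverse_of_injective (LinearMap.ker_eq_bot.mpr hi)
  let Q : V →ₗ[K] C := C.projectionOnto W hC.symm
  let e : Fin s → V := fun j => p (Pi.single j 1)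
  let f : Fin s → V →ₗ[K] K := fun j => LinearMap.proj j ∘ₗ i ∘ₗ Q
  have hQ : ∀ x, (Q x : V) = ∑ j, f j x • e j := fun x => by
    have h1 : p (i (Q x)) = Q x := LinearMap.congr_fun hp (Q x)
    have h2 : i (Q x) = ∑ j, i (Q x) j • Pi.single j 1 := by simpa using pi_eq_sum_univ' (i (Q x))
    rw [← h1, h2]
    simp [f, e]
  have hP : ∀ x, x - Q x ∈ W := fun x => by
    rw [← C.projectionOnto_apply_eq_zero_iff hC.symm, map_sub, C.projectionOnto_apply_left,
      sub_self]
  refine ⟨f, fun j => B (e j), fun j => B.flip (e j) ∘ₗ (LinearMap.id - C.subtype ∘ₗ Q),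
    fun x y => ?_⟩
  have h0 := hW _ (hP x) _ (hP y)
  have h1 : B x y = B (Q x) y + B (x - Q x) (Q y) := by
    simp only [map_sub, LinearMap.sub_apply] at h0 ⊢
    linear_combination h0
  rw [h1, hQ y, Finset.sum_add_distrib]
  nth_rw 1 [hQ x]
  simp [mul_comm]

/-- Adding a one-dimensional orthogonal summand to a form raises the rank of its pencil by at most
one. -/
theorem GenericRankLE.prod {B : V →ₗ[K] V →ₗ[K] K} {k : ℕ} (hB : GenericRankLE B k) :
    GenericRankLE (B.compl₁₂ (LinearMap.fst K V K) (LinearMap.fst K V K) +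
      (LinearMap.mul K K).compl₁₂ (LinearMap.snd K V K) (LinearMap.snd K V K)) (k + 1) := by
  refine hB.mono fun μ hμ => ?_
  let R : (V →ₗ[K] K) →ₗ[K] (V × K →ₗ[K] K) := LinearMap.lcomp K K (LinearMap.fst K V K)
  have hle : finrank K ((range (B + μ • B.flip)).map R ⊔ K ∙ LinearMap.snd K V K :
      Submodule K (V × K →ₗ[K] K)) ≤ k + 1 :=
    (Submodule.finrank_add_le_finrank_add_finrank _ _).trans (add_le_add
      ((Submodule.finrank_map_le R _).trans hμ) (by simpa using finrank_span_le_card {LinearMap.snd K V K}))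
  refine (Submodule.finrank_mono ?_).trans hle
  rintro _ ⟨⟨x, t⟩, rfl⟩
  refine Submodule.mem_sup.mpr ⟨R ((B + μ • B.flip) x), ⟨_, ⟨x, rfl⟩, rfl⟩,
    (t + μ * t) • LinearMap.snd K V K, Submodule.smul_mem _ _ (Submodule.mem_span_singleton_self _),
    ?_⟩
  refine LinearMap.ext fun ⟨y, r⟩ => ?_
  simp [R]
  ring

/-- A form whose pencil has generic rank at most `2 s + 1` is the square of a functional on a
subspace of codimension at most `s`. -/
theorem exists_vanishesOn_sub_square [IsAlgClosed K] [NeZero (2 : K)] {B : V →ₗ[K] V →ₗ[K] K}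
    {s : ℕ} (hB : GenericRankLE B (2 * s + 1)) :
    ∃ (u : V →ₗ[K] K) (W : Submodule K V),
      VanishesOn (B - (LinearMap.mul K K).compl₁₂ u u) W ∧ finrank K V ≤ finrank K W + s := by
  obtain ⟨W, hW, hdim⟩ := exists_vanishesOn (s := s + 1) hB.prod
  let g : W →ₗ[K] V := LinearMap.fst K V K ∘ₗ W.subtype
  have hg : ker g = ⊥ := by
    rw [LinearMap.ker_eq_bot']
    rintro ⟨⟨x, t⟩, hw⟩ hx
    obtain rfl : x = 0 := hx
    have h := hW _ hw _ hw
    obtain rfl : t = 0 := by simpa using h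
    rfl
  obtain ⟨p, hp⟩ := g.exists_leftInverse_of_injective hg
  obtain ⟨ι, hι⟩ := IsAlgClosed.exists_pow_nat_eq (-1 : K) zero_lt_two
  refine ⟨ι • (LinearMap.snd K V K ∘ₗ W.subtype ∘ₗ p), range g, ?_, ?_⟩
  · rintro _ ⟨w, rfl⟩ _ ⟨w', rfl⟩
    have h := hW _ w.2 _ w'.2
    have h1 : p (g w) = w := LinearMap.congr_fun hp w
    have h2 : p (g w') = w' := LinearMap.congr_fun hp w'
    simp only [LinearMap.add_apply, LinearMap.compl₁₂_apply, LinearMap.mul_apply',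
      LinearMap.fst_apply, LinearMap.snd_apply] at h
    simp only [LinearMap.sub_apply, LinearMap.compl₁₂_apply, LinearMap.mul_apply',
      LinearMap.smul_apply, LinearMap.comp_apply, h1, h2, smul_eq_mul, Submodule.subtype_apply,
      LinearMap.snd_apply]
    simp only [g, LinearMap.comp_apply, Submodule.subtype_apply, LinearMap.fst_apply]
    linear_combination h - (w : V × K).2 * (w' : V × K).2 * hι
  · rw [LinearMap.finrank_range_of_inj (LinearMap.ker_eq_bot.mp hg)]
    rw [finrank_prod, finrank_self] at hdim
    lia

end Forms

section Matrices

open Module Filter LinearMap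

variable {K : Type u} [Field K] {m : Type v} [Fintype m] [DecidableEq m]

theorem finrank_range_toBilin'_le (M : Matrix m m K) :
    finrank K (range (Matrix.toBilin' M)) ≤ M.rank := by
  rw [← Matrix.rank_transpose M, Matrix.rank]
  refine (Submodule.finrank_mono ?_).trans
    (Submodule.finrank_map_le (Matrix.toBilin' (1 : Matrix m m K) : (m → K) →ₗ[K] (m → K) →ₗ[K] K) _)
  rintro _ ⟨x, rfl⟩
  refine ⟨_, ⟨x, rfl⟩, LinearMap.ext fun y => ?_⟩
  simp [Matrix.toBilin'_apply', Matrix.dotProduct_mulVec]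

theorem toBilin'_pencil (A : Matrix m m K) (μ : K) :
    Matrix.toBilin' A + μ • LinearMap.flip (Matrix.toBilin' A) =
      Matrix.toBilin' (A + μ • Aᵀ) := by
  refine LinearMap.ext fun x => LinearMap.ext fun y => ?_
  simp [Matrix.toBilin'_apply', Matrix.mulVec_transpose,
    ← Matrix.dotProduct_mulVec, dotProduct_comm x]

theorem genericRankLE_toBilin' {A : Matrix m m K} {r : ℕ}
    (hA : ∀ μ : K, (A + μ • Aᵀ).rank ≤ r) : GenericRankLE (Matrix.toBilin' A) r :=
  Eventually.of_forall fun μ => by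
    rw [toBilin'_pencil]
    exact (finrank_range_toBilin'_le _).trans (hA μ)

end Matrices

/-- **Rank-1 decomposition for ⊤-palindromic pencils.**
If `E(λ) = A + λB` is an `n × n` ⊤-palindromic matrix pencil (`Aᵀ = B`) of rank
`r ≤ n`, and `s = ⌊r/2⌋`, then there exist vectors `v_j ∈ ℂ^n`, vector pencils
`w_j(λ) = c_j + λ d_j` of degree at most one (so `rev w_j(λ) = d_j + λ c_j`), and
(if `r` is odd) a vector `u ∈ ℂ^n`, such that
`A + λB = Σ (v_j w_j(λ)ᵀ + (rev w_j)(λ) v_jᵀ)` if `r` is even, and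
`A + λB = (1+λ) u uᵀ + Σ (v_j w_j(λ)ᵀ + (rev w_j)(λ) v_jᵀ)` if `r` is odd. -/
theorem top_palindromic_rank_one_decomposition
    (n r : ℕ) (hrn : r ≤ n) (A B : Matrix (Fin n) (Fin n) ℂ)
    (hAB : Aᵀ = B)
    (hrank : PencilRankEq n A B r) :
    ∃ (v c d : Fin (r / 2) → Fin n → ℂ) (u : Fin n → ℂ),
      (Even r → ∀ lam : ℂ,
        A + lam • B =
          ∑ j : Fin (r / 2),
            (vecMulVec (v j) (c j + lam • d j)
              + vecMulVec (d j + lam • c j) (v j))) ∧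
      (Odd r → ∀ lam : ℂ,
        A + lam • B =
          ((1 : ℂ) + lam) • vecMulVec u u +
          ∑ j : Fin (r / 2),
            (vecMulVec (v j) (c j + lam • d j)
              + vecMulVec (d j + lam • c j) (v j))) := by
  subst hAB
  have hgen := genericRankLE_toBilin' hrank.2
  rcases Nat.even_or_odd r with hr | hr
  · rw [← Nat.two_mul_div_two_of_even hr] at hgen
    obtain ⟨W, hW, hdim⟩ := exists_vanishesOn hgen
    obtain ⟨f, g, h, hfgh⟩ := hW.exists_eq_sum hdim
    refine ⟨fun j i => f j (Pi.single i 1), fun j i => g j (Pi.single i 1),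
      fun j i => h j (Pi.single i 1), 0, fun _ lam => ?_,
      fun ho => absurd hr (Nat.not_even_iff_odd.mpr ho)⟩
    have hA : ∀ i k, A i k = ∑ j, (f j (Pi.single i 1) * g j (Pi.single k 1) +
        h j (Pi.single i 1) * f j (Pi.single k 1)) := fun i k => by
      rw [← hfgh, Matrix.toBilin'_single]
    ext i k
    simp only [Matrix.add_apply, Matrix.smul_apply, Matrix.transpose_apply, hA, Matrix.sum_apply,
      vecMulVec_apply, Pi.add_apply, Pi.smul_apply, smul_eq_mul, Finset.mul_sum,
      ← Finset.sum_add_distrib]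
    exact Finset.sum_congr rfl fun j _ => by ring
  · rw [← Nat.two_mul_div_two_add_one_of_odd hr] at hgen
    obtain ⟨u, W, hW, hdim⟩ := exists_vanishesOn_sub_square hgen
    obtain ⟨f, g, h, hfgh⟩ := hW.exists_eq_sum hdim
    refine ⟨fun j i => f j (Pi.single i 1), fun j i => g j (Pi.single i 1),
      fun j i => h j (Pi.single i 1), fun i => u (Pi.single i 1),
      fun he => absurd he (Nat.not_even_iff_odd.mpr hr), fun _ lam => ?_⟩
    have hA : ∀ i k, A i k = u (Pi.single i 1) * u (Pi.single k 1) +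
        ∑ j, (f j (Pi.single i 1) * g j (Pi.single k 1) +
          h j (Pi.single i 1) * f j (Pi.single k 1)) := fun i k => by
      rw [← hfgh, LinearMap.sub_apply, LinearMap.sub_apply, Matrix.toBilin'_single,
        LinearMap.compl₁₂_apply, LinearMap.mul_apply', add_sub_cancel]
    ext i k
    simp only [Matrix.add_apply, Matrix.smul_apply, Matrix.transpose_apply, hA, Matrix.sum_apply,
      vecMulVec_apply, Pi.add_apply, Pi.smul_apply, smul_eq_mul]
    rw [mul_add, add_add_add_comm, Finset.mul_sum, ← Finset.sum_add_distrib]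
    congr 1
    · ring
    · exact Finset.sum_congr rfl fun j _ => by ring
end

section
/- Let E(λ)=A+λB be an n×n skew-Hermitian matrix pencil over ℂ (i.e., A^*=−A, B^*=−B) whose rank equals r (r ≤ n). Then there exist nonnegative integers ℓ, s with ℓ+2s=r, real numbers a_1,…,a_ℓ, b_1,…,b_ℓ, vectors u_1,…,u_ℓ, v_1,…,v_s ∈ ℂ^n, and vector pencils w_1,…,w_s of degree at most one such that A+λB = Σ_{i=1}^{ℓ} i(a_i+λb_i) u_i u_i^* + Σ_{j=1}^{s} ( v_j w_j(λ)^* − w_j(λ) v_j^* ), where i denotes the imaginary unit. -/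
open Matrix BigOperators

section SkewHermitianPencil

variable {m : Type*}

/-- The pencil `A + λ B` is a sum of `ℓ` terms `𝕚 (a + λ b) u u^*` and `s` terms
`v w(λ)^* - w(λ) v^*`, where `w` has degree at most one and `ℓ + 2 s = r`. -/
def HasSkewDecomposition (A B : Matrix m m ℂ) (r : ℕ) : Prop :=
  ∃ (ℓ s : ℕ), ℓ + 2 * s = r ∧
    ∃ (a b : Fin ℓ → ℝ) (u : Fin ℓ → m → ℂ) (v c d : Fin s → m → ℂ),
      ∀ lam : ℂ,
        A + lam • B =
          (∑ i : Fin ℓ,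
            (Complex.I * ((a i : ℂ) + lam * (b i : ℂ))) • vecMulVec (u i) (star (u i)))
          + ∑ j : Fin s,
              (vecMulVec (v j) (star (c j) + lam • star (d j))
                - vecMulVec (c j + lam • d j) (star (v j)))

theorem HasSkewDecomposition.zero (r : ℕ) :
    HasSkewDecomposition (0 : Matrix m m ℂ) 0 r :=
  ⟨r, 0, by simp, 0, 0, 0, 0, 0, 0, fun lam => by simp⟩

theorem HasSkewDecomposition.add_rank_one {A B : Matrix m m ℂ} {r : ℕ}
    (h : HasSkewDecomposition A B r) (a b : ℝ) (u : m → ℂ) :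
    HasSkewDecomposition (A + (Complex.I * a) • vecMulVec u (star u))
      (B + (Complex.I * b) • vecMulVec u (star u)) (r + 1) := by
  obtain ⟨ℓ, s, hr, a', b', u', v, c, d, hdec⟩ := h
  refine ⟨ℓ + 1, s, by omega, Fin.cons a a', Fin.cons b b', Fin.cons u u', v, c, d,
    fun lam => ?_⟩
  simp only [Fin.sum_univ_succ, Fin.cons_zero, Fin.cons_succ]
  rw [add_assoc (_ • _), ← hdec]
  module

theorem HasSkewDecomposition.add_rank_two {A B : Matrix m m ℂ} {r : ℕ}
    (h : HasSkewDecomposition A B r) (v c d : m → ℂ) :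
    HasSkewDecomposition (A + (vecMulVec v (star c) - vecMulVec c (star v)))
      (B + (vecMulVec v (star d) - vecMulVec d (star v))) (r + 2) := by
  obtain ⟨ℓ, s, hr, a, b, u, v', c', d', hdec⟩ := h
  refine ⟨ℓ, s + 1, by omega, a, b, u, Fin.cons v v', Fin.cons c c', Fin.cons d d',
    fun lam => ?_⟩
  simp only [Fin.sum_univ_succ, Fin.cons_zero, Fin.cons_succ]
  rw [add_left_comm, ← hdec, vecMulVec_add, add_vecMulVec, vecMulVec_smul, smul_vecMulVec]
  module

theorem conjTranspose_add_ofReal_smul {A B : Matrix m m ℂ} (hA : Aᴴ = -A) (hB : Bᴴ = -B)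
    (t : ℝ) : (A + (t : ℂ) • B)ᴴ = -(A + (t : ℂ) • B) := by
  rw [conjTranspose_add, conjTranspose_smul, hA, hB, Complex.star_def, Complex.conj_ofReal,
    smul_neg, neg_add]

variable [Fintype m]

theorem star_mulVec_dotProduct_of_skew {M : Matrix m m ℂ} (hM : Mᴴ = -M) (x z : m → ℂ) :
    star (M *ᵥ x) ⬝ᵥ z = -(star x ⬝ᵥ M *ᵥ z) := by
  rw [star_mulVec, hM, ← dotProduct_mulVec, neg_mulVec, dotProduct_neg]

open scoped ComplexOrder in
theorem star_dotProduct_self_eq_zero_iff {z : m → ℂ} : star z ⬝ᵥ z = 0 ↔ z = 0 :=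
  dotProduct_star_self_eq_zero

/-- A nonzero skew-Hermitian pencil has an eigenvector outside the common kernel. -/
theorem exists_pencil_eigenvector [DecidableEq m] {A B : Matrix m m ℂ} (hA : Aᴴ = -A)
    (hB : Bᴴ = -B) (hne : A ≠ 0 ∨ B ≠ 0) :
    ∃ (x y : m → ℂ) (p q : ℂ), y ≠ 0 ∧ (p ≠ 0 ∨ q ≠ 0) ∧ A *ᵥ x = p • y ∧ B *ᵥ x = q • y := by
  set U : Submodule ℂ (m → ℂ) := A.mulVecLin.range ⊔ B.mulVecLin.range
  have hAU : ∀ z, A *ᵥ z ∈ U := fun z => Submodule.mem_sup_left ⟨z, rfl⟩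
  have hBU : ∀ z, B *ᵥ z ∈ U := fun z => Submodule.mem_sup_right ⟨z, rfl⟩
  have hker : ∀ z ∈ U, A *ᵥ z = 0 → B *ᵥ z = 0 → z = 0 := by
    intro z hz hAz hBz
    obtain ⟨_, ⟨f, rfl⟩, _, ⟨g, rfl⟩, hfg⟩ := Submodule.mem_sup.1 hz
    simp only [mulVecLin_apply] at hfg
    have hf := star_mulVec_dotProduct_of_skew hA z f
    have hg := star_mulVec_dotProduct_of_skew hB z g
    simp only [hAz, hBz, star_zero, zero_dotProduct, zero_eq_neg] at hf hg
    rw [← star_dotProduct_self_eq_zero_iff]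
    calc star z ⬝ᵥ z = star z ⬝ᵥ (A *ᵥ f + B *ᵥ g) := by rw [hfg]
      _ = 0 := by rw [dotProduct_add, hf, hg, add_zero]
  have hUne : U ≠ ⊥ := by
    intro h
    have key : ∀ M : Matrix m m ℂ, (∀ z, M *ᵥ z ∈ U) → M = 0 := fun M hM => by
      refine Matrix.mulVec_injective (funext fun z => ?_)
      have := hM z
      rw [h, Submodule.mem_bot] at this
      rw [this, zero_mulVec]
    exact hne.elim (fun h => h (key A hAU)) (fun h => h (key B hBU))
  have : Nontrivial U := Submodule.nontrivial_iff_ne_bot.2 hUne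
  let TA : U →ₗ[ℂ] U := A.mulVecLin.restrict fun z _ => hAU z
  let TB : U →ₗ[ℂ] U := B.mulVecLin.restrict fun z _ => hBU z
  by_cases hinj : Function.Injective TB
  · let e : U ≃ₗ[ℂ] U := LinearEquiv.ofInjectiveEndo TB hinj
    obtain ⟨μ, hμ⟩ := Module.End.exists_eigenvalue (e.symm.toLinearMap ∘ₗ TA)
    obtain ⟨x, hx⟩ := hμ.exists_hasEigenvector
    have h1 : e.symm (TA x) = μ • x := hx.apply_eq_smul
    have h2 : TA x = μ • TB x := by
      rw [LinearEquiv.symm_apply_eq, map_smul] at h1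
      exact h1
    refine ⟨x, B *ᵥ x, μ, 1, fun h => hx.2 (hinj ?_), Or.inr one_ne_zero,
      congrArg Subtype.val h2, (one_smul _ _).symm⟩
    rw [map_zero]
    exact Subtype.ext h
  · rw [← LinearMap.ker_eq_bot, Submodule.eq_bot_iff] at hinj
    push Not at hinj
    obtain ⟨x, hx, hx0⟩ := hinj
    have hBx : B *ᵥ (x : m → ℂ) = 0 := congrArg Subtype.val (LinearMap.mem_ker.1 hx)
    exact ⟨x, A *ᵥ x, 1, 0, fun h => hx0 (Subtype.ext (hker x x.2 h hBx)), Or.inl one_ne_zero,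
      (one_smul _ _).symm, by rw [hBx, zero_smul]⟩

theorem rank_add_finrank_ker (M : Matrix m m ℂ) :
    M.rank + Module.finrank ℂ M.mulVecLin.ker = Fintype.card m := by
  rw [Matrix.rank, LinearMap.finrank_range_add_finrank_ker, Module.finrank_fintype_fun_eq_card]

/-- Subtracting a non-isotropic eigenvector direction lowers the rank. -/
theorem rank_sub_smul_vecMulVec_lt {M : Matrix m m ℂ} (hM : Mᴴ = -M) {x y : m → ℂ} {k : ℂ}
    (hk : k ≠ 0) (hx : M *ᵥ x = k • y) (hxy : star x ⬝ᵥ y = 1) :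
    (M - k • vecMulVec y (star y)).rank + 1 ≤ M.rank := by
  have hyx : star y ⬝ᵥ x = 1 := by
    rw [star_dotProduct, hxy, star_one]
  have hmul : ∀ z, (M - k • vecMulVec y (star y)) *ᵥ z = M *ᵥ z - (k * (star y ⬝ᵥ z)) • y := by
    intro z
    rw [sub_mulVec, smul_mulVec, vecMulVec_mulVec, op_smul_eq_smul, smul_smul]
  have hlt : M.mulVecLin.ker < (M - k • vecMulVec y (star y)).mulVecLin.ker := by
    refine lt_of_le_of_ne (fun z hz => ?_) fun h => ?_
    · rw [LinearMap.mem_ker, mulVecLin_apply] at hz ⊢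
      have h := star_mulVec_dotProduct_of_skew hM x z
      rw [hz, hx, star_smul, smul_dotProduct, dotProduct_zero, neg_zero, smul_eq_zero,
        star_eq_zero] at h
      rw [hmul, hz, h.resolve_left hk, mul_zero, zero_smul, sub_zero]
    · have hxk : x ∈ M.mulVecLin.ker := by
        rw [h, LinearMap.mem_ker, mulVecLin_apply, hmul, hx, hyx, mul_one, sub_self]
      rw [LinearMap.mem_ker, mulVecLin_apply, hx, smul_eq_zero] at hxk
      rw [hxk.resolve_left hk, dotProduct_zero] at hxy
      exact zero_ne_one hxy
  have := Submodule.finrank_lt_finrank_of_lt hlt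
  have h1 := rank_add_finrank_ker M
  have h2 := rank_add_finrank_ker (M - k • vecMulVec y (star y))
  omega

/-- The orthogonal projection along the vector `y`. -/
noncomputable def projAlong [DecidableEq m] (y : m → ℂ) : Matrix m m ℂ :=
  1 - (star y ⬝ᵥ y)⁻¹ • vecMulVec y (star y)

theorem projAlong_mulVec [DecidableEq m] (y z : m → ℂ) :
    projAlong y *ᵥ z = z - ((star y ⬝ᵥ y)⁻¹ * (star y ⬝ᵥ z)) • y := by
  rw [projAlong, sub_mulVec, one_mulVec, smul_mulVec, vecMulVec_mulVec, op_smul_eq_smul, smul_smul]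

theorem star_star_dotProduct_self (y : m → ℂ) : star (star y ⬝ᵥ y) = star y ⬝ᵥ y :=
  (star_dotProduct y y).symm

theorem projAlong_conjTranspose [DecidableEq m] (y : m → ℂ) : (projAlong y)ᴴ = projAlong y := by
  rw [projAlong, conjTranspose_sub, conjTranspose_one, conjTranspose_smul,
    conjTranspose_vecMulVec, star_star, star_inv₀, star_star_dotProduct_self]

/-- Compressing to the orthogonal complement of an isotropic eigenvector direction lowers the
rank by two. -/
theorem rank_projAlong_mul_mul_add_two_le [DecidableEq m] {M : Matrix m m ℂ} (hM : Mᴴ = -M)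
    {x y : m → ℂ} {k : ℂ} (hk : k ≠ 0) (hy : y ≠ 0) (hx : M *ᵥ x = k • y)
    (hxy : star x ⬝ᵥ y = 0) :
    (projAlong y * M * projAlong y).rank + 2 ≤ M.rank := by
  have hyy : star y ⬝ᵥ y ≠ 0 := by rwa [Ne, star_dotProduct_self_eq_zero_iff]
  have hyx : star y ⬝ᵥ x = 0 := by
    rw [star_dotProduct, hxy, star_zero]
  have hPy : projAlong y *ᵥ y = 0 := by
    rw [projAlong_mulVec, inv_mul_cancel₀ hyy, one_smul, sub_self]
  have hP : ∀ z, star y ⬝ᵥ z = 0 → projAlong y *ᵥ z = z := fun z hz => by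
    rw [projAlong_mulVec, hz, mul_zero, zero_smul, sub_zero]
  have hkerM : ∀ z, M *ᵥ z = 0 → star y ⬝ᵥ z = 0 := by
    intro z hz
    have h := star_mulVec_dotProduct_of_skew hM x z
    rw [hz, hx, star_smul, smul_dotProduct, dotProduct_zero, neg_zero, smul_eq_zero,
      star_eq_zero] at h
    exact h.resolve_left hk
  set N := projAlong y * M * projAlong y with hN
  have hmul : ∀ z, N *ᵥ z = projAlong y *ᵥ (M *ᵥ (projAlong y *ᵥ z)) := by
    intro z
    rw [mulVec_mulVec, mulVec_mulVec, hN, Matrix.mul_assoc]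
  have hlt₁ : M.mulVecLin.ker < M.mulVecLin.ker ⊔ ℂ ∙ x := by
    refine lt_of_le_of_ne le_sup_left fun h => ?_
    have hxk : x ∈ M.mulVecLin.ker :=
      h ▸ Submodule.mem_sup_right (Submodule.mem_span_singleton_self x)
    rw [LinearMap.mem_ker, mulVecLin_apply, hx, smul_eq_zero] at hxk
    exact hxk.elim hk hy
  have horth : ∀ z ∈ M.mulVecLin.ker ⊔ ℂ ∙ x, star y ⬝ᵥ z = 0 := by
    intro z hz
    obtain ⟨f, hf, g, hg, rfl⟩ := Submodule.mem_sup.1 hz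
    obtain ⟨c, rfl⟩ := Submodule.mem_span_singleton.1 hg
    rw [dotProduct_add, hkerM f hf, dotProduct_smul, hyx, smul_zero, add_zero]
  have hlt₂ : M.mulVecLin.ker ⊔ ℂ ∙ x < N.mulVecLin.ker := by
    refine lt_of_le_of_ne (sup_le (fun z hz => ?_) ?_) fun h => ?_
    · rw [LinearMap.mem_ker, mulVecLin_apply] at hz ⊢
      rw [hmul, hP z (hkerM z hz), hz, mulVec_zero]
    · rw [Submodule.span_singleton_le_iff_mem, LinearMap.mem_ker, mulVecLin_apply, hmul,
        hP x hyx, hx, mulVec_smul, hPy, smul_zero]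
    · refine hyy (horth y ?_)
      rw [h, LinearMap.mem_ker, mulVecLin_apply, hmul, hPy, mulVec_zero, mulVec_zero]
  have hf₁ := Submodule.finrank_lt_finrank_of_lt hlt₁
  have hf₂ := Submodule.finrank_lt_finrank_of_lt hlt₂
  have h1 := rank_add_finrank_ker M
  have h2 := rank_add_finrank_ker N
  omega

/-- A skew-Hermitian matrix differs from its compression to the orthogonal complement of `y`
by a term `y c^* - c y^*`. -/
theorem exists_eq_projAlong_mul_mul_add [DecidableEq m] {A : Matrix m m ℂ} (hA : Aᴴ = -A)
    (y : m → ℂ) :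
    ∃ c : m → ℂ, A = projAlong y * A * projAlong y +
      (vecMulVec y (star c) - vecMulVec c (star y)) := by
  set κ : ℂ := (star y ⬝ᵥ y)⁻¹ with hκ
  set g : ℂ := star y ⬝ᵥ A *ᵥ y with hg
  have hκs : star κ = κ := by rw [hκ, star_inv₀, star_star_dotProduct_self]
  have hgs : star g = -g := by
    have h := star_mulVec_dotProduct_of_skew hA y y
    rw [hg, ← h, star_dotProduct, star_star]
  have hvA : star (A *ᵥ y) = -(star y ᵥ* A) := by
    rw [star_mulVec, hA, vecMul_neg]
  refine ⟨-κ • A *ᵥ y + (κ ^ 2 * g / 2) • y, ?_⟩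
  have hc : star (-κ • A *ᵥ y + (κ ^ 2 * g / 2) • y) =
      κ • (star y ᵥ* A) - (κ ^ 2 * g / 2) • star y := by
    rw [star_add, star_smul, star_smul, hvA, star_neg, hκs, star_div₀, star_mul', star_pow, hκs,
      hgs, star_ofNat]
    module
  rw [hc, projAlong, ← hκ, Matrix.mul_sub, Matrix.mul_one, Matrix.mul_smul, Matrix.sub_mul,
    Matrix.one_mul, Matrix.smul_mul, Matrix.sub_mul, Matrix.smul_mul, mul_vecMulVec,
    vecMulVec_mul, vecMulVec_mul_vecMulVec, ← dotProduct_mulVec, ← hg,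
    vecMulVec_sub, vecMulVec_smul, vecMulVec_smul, vecMulVec_smul, add_vecMulVec, smul_vecMulVec,
    smul_vecMulVec]
  module

theorem eventually_add_ofReal_mul_ne_zero {p q : ℂ} (hpq : p ≠ 0 ∨ q ≠ 0) :
    ∀ᶠ t : ℝ in Filter.cofinite, p + t * q ≠ 0 := by
  refine Set.Subsingleton.finite fun t ht t' ht' => ?_
  simp only [Set.mem_compl_iff, Set.mem_ofPred_eq, not_not] at ht ht'
  by_contra hne
  have hq : ((t : ℂ) - t') * q = 0 := by linear_combination ht - ht'
  have hq0 : q = 0 :=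
    (mul_eq_zero.1 hq).resolve_left (sub_ne_zero.2 fun h => hne (Complex.ofReal_injective h))
  rw [hq0, mul_zero, add_zero] at ht
  exact hpq.elim (fun h => h ht) (fun h => h hq0)

theorem hasSkewDecomposition_of_eventually_rank_le [DecidableEq m] (r : ℕ) :
    ∀ A B : Matrix m m ℂ, Aᴴ = -A → Bᴴ = -B →
      (∀ᶠ t : ℝ in Filter.cofinite, (A + (t : ℂ) • B).rank ≤ r) →
        HasSkewDecomposition A B r := by
  induction r using Nat.strong_induction_on with
  | _ r ih =>
  intro A B hA hB hr
  by_cases h0 : A = 0 ∧ B = 0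
  · rw [h0.1, h0.2]
    exact .zero r
  obtain ⟨x, y, p, q, hy, hpq, hAx, hBx⟩ := exists_pencil_eigenvector hA hB
    (not_and_or.1 h0)
  by_cases hxy : star x ⬝ᵥ y = 0
  · have hstep : ∀ᶠ t : ℝ in Filter.cofinite,
        (projAlong y * A * projAlong y + (t : ℂ) • (projAlong y * B * projAlong y)).rank + 2
          ≤ r := by
      filter_upwards [hr, eventually_add_ofReal_mul_ne_zero hpq] with t ht hk
      have hx : (A + (t : ℂ) • B) *ᵥ x = (p + t * q) • y := by
        rw [add_mulVec, smul_mulVec, hAx, hBx, smul_smul, add_smul]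
      have h := rank_projAlong_mul_mul_add_two_le (conjTranspose_add_ofReal_smul hA hB t)
        hk hy hx hxy
      rw [Matrix.mul_add, Matrix.add_mul, Matrix.mul_smul, Matrix.smul_mul] at h
      exact h.trans ht
    obtain ⟨k, rfl⟩ : ∃ k, r = k + 2 :=
      ⟨r - 2, by obtain ⟨t, ht⟩ := hstep.exists; omega⟩
    have hskew : ∀ {M : Matrix m m ℂ}, Mᴴ = -M →
        (projAlong y * M * projAlong y)ᴴ = -(projAlong y * M * projAlong y) := by
      intro M hM
      rw [conjTranspose_mul, conjTranspose_mul, projAlong_conjTranspose, hM, Matrix.neg_mul,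
        Matrix.mul_neg, Matrix.mul_assoc]
    obtain ⟨c, hc⟩ := exists_eq_projAlong_mul_mul_add hA y
    obtain ⟨d, hd⟩ := exists_eq_projAlong_mul_mul_add hB y
    rw [hc, hd]
    refine (ih k (by omega) _ _ (hskew hA) (hskew hB) ?_).add_rank_two y c d
    filter_upwards [hstep] with t ht using by omega
  · obtain ⟨y', hxy', p', q', hpq', hAx', hBx'⟩ : ∃ y', star x ⬝ᵥ y' = 1 ∧ ∃ p' q' : ℂ,
        (p' ≠ 0 ∨ q' ≠ 0) ∧ A *ᵥ x = p' • y' ∧ B *ᵥ x = q' • y' := by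
      refine ⟨(star x ⬝ᵥ y)⁻¹ • y, ?_, p * (star x ⬝ᵥ y), q * (star x ⬝ᵥ y),
        hpq.imp (mul_ne_zero · hxy) (mul_ne_zero · hxy), ?_, ?_⟩
      · rw [dotProduct_smul, smul_eq_mul, inv_mul_cancel₀ hxy]
      · rw [hAx, smul_smul, mul_inv_cancel_right₀ hxy]
      · rw [hBx, smul_smul, mul_inv_cancel_right₀ hxy]
    have him : ∀ {M : Matrix m m ℂ} {k : ℂ}, Mᴴ = -M → M *ᵥ x = k • y' →
        k = Complex.I * k.im := by
      intro M k hM hx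
      have hk : star x ⬝ᵥ M *ᵥ x = k := by rw [hx, dotProduct_smul, hxy', smul_eq_mul, mul_one]
      have hs : star k = -k := by
        have h := star_mulVec_dotProduct_of_skew hM x x
        rw [hk] at h
        rw [← h, ← hk, star_dotProduct, star_star]
      have hre := congrArg Complex.re hs
      simp only [Complex.star_def, Complex.conj_re, Complex.neg_re] at hre
      apply Complex.ext <;> simp
      linarith
    have hp := him hA hAx'
    have hq := him hB hBx'
    have hskew : ∀ {M : Matrix m m ℂ} (a : ℝ), Mᴴ = -M →
        (M - (Complex.I * a) • vecMulVec y' (star y'))ᴴ =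
          -(M - (Complex.I * a) • vecMulVec y' (star y')) := by
      intro M a hM
      rw [conjTranspose_sub, conjTranspose_smul, conjTranspose_vecMulVec, star_star, hM,
        star_mul', Complex.star_def, Complex.conj_I, Complex.conj_ofReal]
      module
    have hstep : ∀ᶠ t : ℝ in Filter.cofinite,
        (A - (Complex.I * p'.im) • vecMulVec y' (star y') +
          (t : ℂ) • (B - (Complex.I * q'.im) • vecMulVec y' (star y'))).rank + 1 ≤ r := by
      filter_upwards [hr, eventually_add_ofReal_mul_ne_zero hpq'] with t ht hk
      have hx : (A + (t : ℂ) • B) *ᵥ x = (p' + t * q') • y' := by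
        rw [add_mulVec, smul_mulVec, hAx', hBx', smul_smul, add_smul]
      have h := rank_sub_smul_vecMulVec_lt (conjTranspose_add_ofReal_smul hA hB t) hk hx hxy'
      rw [← hp, ← hq]
      refine le_trans (le_of_eq ?_) (h.trans ht)
      congr 2
      module
    obtain ⟨k, rfl⟩ : ∃ k, r = k + 1 :=
      ⟨r - 1, by obtain ⟨t, ht⟩ := hstep.exists; omega⟩
    have hdec := (ih k (by omega) _ _ (hskew p'.im hA) (hskew q'.im hB)
      (by filter_upwards [hstep] with t ht using by omega)).add_rank_one p'.im q'.im y'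
    rwa [sub_add_cancel, sub_add_cancel] at hdec

end SkewHermitianPencil

/-- **Rank-1 decomposition for skew-Hermitian pencils.**
If `E(λ) = A + λB` is an `n × n` skew-Hermitian matrix pencil (`Aᴴ = -A`, `Bᴴ = -B`)
of rank `r ≤ n`, then there exist `ℓ, s` with `ℓ + 2s = r`, real numbers `a_i, b_i`,
vectors `u_i, v_j ∈ ℂ^n`, and vector pencils `w_j(λ) = c_j + λ d_j` of degree at most
one such that `A + λB = Σ 𝕚 (a_i + λ b_i) u_i u_i^* + Σ (v_j w_j(λ)^* − w_j(λ) v_j^*)`. -/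
theorem skew_hermitian_rank_one_decomposition
    (n r : ℕ) (hrn : r ≤ n) (A B : Matrix (Fin n) (Fin n) ℂ)
    (hA : Aᴴ = -A) (hB : Bᴴ = -B)
    (hrank : PencilRankEq n A B r) :
    ∃ (ℓ s : ℕ), ℓ + 2 * s = r ∧
      ∃ (a b : Fin ℓ → ℝ) (u : Fin ℓ → Fin n → ℂ)
        (v c d : Fin s → Fin n → ℂ),
        ∀ lam : ℂ,
          A + lam • B =
            (∑ i : Fin ℓ,
              (Complex.I * ((a i : ℂ) + lam * (b i : ℂ))) • vecMulVec (u i) (star (u i)))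
            + ∑ j : Fin s,
                (vecMulVec (v j) (star (c j) + lam • star (d j))
                  - vecMulVec (c j + lam • d j) (star (v j))) := by
  exact hasSkewDecomposition_of_eventually_rank_le r A B hA hB
    (Filter.Eventually.of_forall fun t => hrank.2 t)
end

section
/- Let E(λ)=A+λB be an n×n *-even matrix pencil over ℂ (i.e., A^*=A, B^*=−B) whose rank equals r (r ≤ n). Then there exist nonnegative integers ℓ, s with ℓ+2s=r, real numbers a_1,…,a_ℓ, b_1,…,b_ℓ, vectors u_1,…,u_ℓ, v_1,…,v_s ∈ ℂ^n, and vector pencils w_1,…,w_s of degree at most one such that A+λB = Σ_{i=1}^{ℓ} (a_i+λ i b_i) u_i u_i^* + Σ_{j=1}^{s} ( v_j w_j(λ)^* + w_j(−λ) v_j^* ), where i denotes the imaginary unit. -/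
open Matrix BigOperators

/-- Simultaneous decomposition of `A` and `C` into `ℓ` Hermitian rank-one terms and `s` terms
`v w* + w v*` sharing the vectors `u` and `v`, with `ℓ + 2 s = r`. -/
def HasHermitianPencilDecomposition {n : ℕ} (r : ℕ) (A C : Matrix (Fin n) (Fin n) ℂ) : Prop :=
  ∃ (ℓ s : ℕ), ℓ + 2 * s = r ∧
    ∃ (a b : Fin ℓ → ℝ) (u : Fin ℓ → Fin n → ℂ) (v c d : Fin s → Fin n → ℂ),
      A = ∑ i, (a i : ℂ) • vecMulVec (u i) (star (u i))
        + ∑ j, (vecMulVec (v j) (star (c j)) + vecMulVec (c j) (star (v j))) ∧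
      C = ∑ i, (b i : ℂ) • vecMulVec (u i) (star (u i))
        + ∑ j, (vecMulVec (v j) (star (d j)) + vecMulVec (d j) (star (v j)))

namespace HasHermitianPencilDecomposition

variable {n r : ℕ} {A C : Matrix (Fin n) (Fin n) ℂ}

theorem zero (n r : ℕ) :
    HasHermitianPencilDecomposition r (0 : Matrix (Fin n) (Fin n) ℂ) 0 :=
  ⟨r, 0, by simp, 0, 0, 0, 0, 0, 0, by simp, by simp⟩

theorem add_rank_one (h : HasHermitianPencilDecomposition r A C) (α β : ℝ) (p : Fin n → ℂ) :
    HasHermitianPencilDecomposition (r + 1) ((α : ℂ) • vecMulVec p (star p) + A)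
      ((β : ℂ) • vecMulVec p (star p) + C) := by
  obtain ⟨ℓ, s, hr, a, b, u, v, c, d, rfl, rfl⟩ := h
  refine ⟨ℓ + 1, s, by omega, Fin.cons α a, Fin.cons β b, Fin.cons p u, v, c, d, ?_, ?_⟩ <;>
    simp [Fin.sum_univ_succ, add_assoc]

theorem add_rank_two (h : HasHermitianPencilDecomposition r A C) (p x y : Fin n → ℂ) :
    HasHermitianPencilDecomposition (r + 2)
      (vecMulVec p (star x) + vecMulVec x (star p) + A)
      (vecMulVec p (star y) + vecMulVec y (star p) + C) := by
  obtain ⟨ℓ, s, hr, a, b, u, v, c, d, rfl, rfl⟩ := h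
  refine ⟨ℓ, s + 1, by omega, a, b, u, Fin.cons p v, Fin.cons x c, Fin.cons y d, ?_, ?_⟩ <;>
    simp only [Fin.sum_univ_succ, Fin.cons_zero, Fin.cons_succ] <;> abel

end HasHermitianPencilDecomposition

theorem Matrix.rank_mul_lt_of_mulVec_eq_zero {n : ℕ} (Q M : Matrix (Fin n) (Fin n) ℂ)
    {p z : Fin n → ℂ} (hp : p ≠ 0) (hQ : Q *ᵥ p = 0) (hz : M *ᵥ z = p) :
    (Q * M).rank < M.rank := by
  have h1 := LinearMap.finrank_range_add_finrank_ker M.mulVecLin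
  have h2 := LinearMap.finrank_range_add_finrank_ker (Q * M).mulVecLin
  have h3 : LinearMap.ker M.mulVecLin < LinearMap.ker (Q * M).mulVecLin := by
    refine SetLike.lt_iff_le_and_exists.2 ⟨fun w hw => ?_, z, ?_, ?_⟩
    · simp only [LinearMap.mem_ker, mulVecLin_apply] at hw ⊢
      rw [← mulVec_mulVec, hw, mulVec_zero]
    · simp only [LinearMap.mem_ker, mulVecLin_apply]
      rw [← mulVec_mulVec, hz, hQ]
    · simpa only [LinearMap.mem_ker, mulVecLin_apply, hz] using hp
  have h4 := Submodule.finrank_lt_finrank_of_lt h3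
  unfold Matrix.rank
  omega

open scoped ComplexOrder in
/-- A nonzero Hermitian pencil has a vector whose images under both coefficients span a line. -/
theorem exists_mulVec_eq_smul_common {n : ℕ} {A C : Matrix (Fin n) (Fin n) ℂ}
    (hA : Aᴴ = A) (hC : Cᴴ = C) (h : ¬ (A = 0 ∧ C = 0)) :
    ∃ (y p : Fin n → ℂ) (α β : ℂ), p ≠ 0 ∧ (α ≠ 0 ∨ β ≠ 0) ∧ A *ᵥ y = α • p ∧ C *ᵥ y = β • p := by
  let R := LinearMap.range A.mulVecLin ⊔ LinearMap.range C.mulVecLin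
  have hAR : ∀ x, A *ᵥ x ∈ R := fun x => Submodule.mem_sup_left ⟨x, rfl⟩
  have hCR : ∀ x, C *ᵥ x ∈ R := fun x => Submodule.mem_sup_right ⟨x, rfl⟩
  have hker : ∀ z ∈ R, A *ᵥ z = 0 → C *ᵥ z = 0 → z = 0 := by
    intro z hz hAz hCz
    obtain ⟨_, ⟨a, rfl⟩, _, ⟨b, rfl⟩, hab⟩ := Submodule.mem_sup.1 hz
    rw [← dotProduct_star_self_eq_zero]
    nth_rw 1 [← hab]
    rw [mulVecLin_apply, mulVecLin_apply, star_add, star_mulVec, star_mulVec, hA, hC,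
      add_dotProduct, ← dotProduct_mulVec, hAz, ← dotProduct_mulVec, hCz]
    simp
  let f : R →ₗ[ℂ] R := A.mulVecLin.restrict fun x _ => hAR x
  let g : R →ₗ[ℂ] R := C.mulVecLin.restrict fun x _ => hCR x
  by_cases hg : Function.Injective g
  · have hnt : Nontrivial R := by
      rw [Submodule.nontrivial_iff_ne_bot]
      intro hbot
      apply h
      constructor <;> refine Matrix.mulVec_injective (funext fun x => ?_)
      · simpa [hbot] using hAR x
      · simpa [hbot] using hCR x
    let e := LinearEquiv.ofInjectiveEndo g hg
    obtain ⟨μ, hμ⟩ := Module.End.exists_eigenvalue (e.symm.toLinearMap ∘ₗ f)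
    obtain ⟨y, hy⟩ := hμ.exists_hasEigenvector
    have h1 : f y = μ • g y := by
      have h2 := congrArg e hy.apply_eq_smul
      simpa [e] using h2
    refine ⟨y, C *ᵥ y, μ, 1, fun h0 => hy.2 (hg ?_), Or.inr one_ne_zero,
      congrArg Subtype.val h1, (one_smul _ _).symm⟩
    rw [map_zero]
    exact Subtype.ext h0
  · rw [← LinearMap.ker_eq_bot, Submodule.eq_bot_iff] at hg
    push Not at hg
    obtain ⟨y, hy, hy0⟩ := hg
    have hCy : C *ᵥ (y : Fin n → ℂ) = 0 := congrArg Subtype.val (LinearMap.mem_ker.1 hy)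
    refine ⟨y, A *ᵥ y, 1, 0, fun h0 => hy0 (Subtype.ext (hker y y.2 h0 hCy)),
      Or.inl one_ne_zero, (one_smul _ _).symm, by simpa using hCy⟩

theorem eventually_cofinite_add_mul_ne_zero {α β : ℂ} (h : α ≠ 0 ∨ β ≠ 0) :
    ∀ᶠ x : ℝ in Filter.cofinite, α + x * β ≠ 0 := by
  rw [Filter.eventually_cofinite]
  refine Set.Subsingleton.finite fun x hx y hy => ?_
  simp only [not_not, Set.mem_ofPred_eq] at hx hy
  have hβ : β ≠ 0 := by
    rintro rfl
    simp_all
  have : ((x : ℂ) - y) * β = 0 := by linear_combination hx - hy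
  exact_mod_cast sub_eq_zero.1 ((mul_eq_zero.1 this).resolve_right hβ)

theorem exists_ofReal_eq_star_dotProduct_mulVec {n : ℕ} {A : Matrix (Fin n) (Fin n) ℂ}
    (hA : Aᴴ = A) (y : Fin n → ℂ) : ∃ a : ℝ, star y ⬝ᵥ (A *ᵥ y) = (a : ℂ) := by
  refine Complex.conj_eq_iff_real.1 ?_
  change star (star y ⬝ᵥ (A *ᵥ y)) = _
  rw [← star_dotProduct, star_mulVec, hA, ← dotProduct_mulVec]

open scoped ComplexOrder in
/-- Splitting a Hermitian matrix along the orthogonal projection with kernel spanned by `p`. -/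
theorem exists_compression_eq {n : ℕ} {p : Fin n → ℂ} (hp : p ≠ 0) :
    ∃ P : Matrix (Fin n) (Fin n) ℂ, Pᴴ = P ∧ P *ᵥ p = 0 ∧
      (∀ y, star p ⬝ᵥ y = 0 → P *ᵥ y = y) ∧
      ∀ A : Matrix (Fin n) (Fin n) ℂ, Aᴴ = A →
        ∃ c, A = vecMulVec p (star c) + vecMulVec c (star p) + P * A * P := by
  set N : ℂ := star p ⬝ᵥ p with hN
  have hN0 : N ≠ 0 := fun h => hp (dotProduct_star_self_eq_zero.1 h)
  have hNs : star N = N := by rw [hN, ← star_dotProduct]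
  have hNs' : star N⁻¹ = N⁻¹ := by rw [star_inv₀, hNs]
  refine ⟨1 - N⁻¹ • vecMulVec p (star p), ?_, ?_, ?_, ?_⟩
  · simp only [conjTranspose_sub, conjTranspose_one, conjTranspose_smul, conjTranspose_vecMulVec,
      hNs', star_star]
  · simp only [sub_mulVec, one_mulVec, smul_mulVec, vecMulVec_mulVec, ← hN]
    ext i
    simp
    field_simp
    simp
  · intro y hy
    simp [sub_mulVec, smul_mulVec, vecMulVec_mulVec, hy]
  · intro A hA
    obtain ⟨κ, hκ⟩ := exists_ofReal_eq_star_dotProduct_mulVec hA p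
    have hpA : star p ᵥ* A = star (A *ᵥ p) := by rw [star_mulVec, hA]
    have hκ' : star (A *ᵥ p) ⬝ᵥ p = κ := by rw [← hpA, ← dotProduct_mulVec, hκ]
    refine ⟨N⁻¹ • (A *ᵥ p) - (κ / (2 * N ^ 2)) • p, ?_⟩
    simp only [star_sub, star_smul, hNs', star_div₀, star_mul', star_pow, hNs, star_ofNat,
      Matrix.sub_mul, Matrix.mul_sub, Matrix.one_mul, Matrix.mul_one, Matrix.smul_mul,
      Matrix.mul_smul, vecMulVec_mul, mul_vecMulVec, hpA, sub_mulVec, smul_mulVec,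
      vecMulVec_mulVec, hκ']
    ext i j
    simp [vecMulVec_apply]
    field_simp
    ring

open scoped ComplexOrder in
theorem hasHermitianPencilDecomposition_of_rank_le {n : ℕ} (r : ℕ) :
    ∀ A C : Matrix (Fin n) (Fin n) ℂ, Aᴴ = A → Cᴴ = C →
      (∀ᶠ x : ℝ in Filter.cofinite, (A + (x : ℂ) • C).rank ≤ r) →
      HasHermitianPencilDecomposition r A C := by
  induction r using Nat.strong_induction_on with
  | _ r ih =>
  intro A C hA hC hrank
  by_cases h0 : A = 0 ∧ C = 0
  · obtain ⟨rfl, rfl⟩ := h0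
    exact .zero n r
  obtain ⟨y, p, α, β, hp, hαβ, hAy, hCy⟩ := exists_mulVec_eq_smul_common hA hC h0
  have hH : ∀ x : ℝ, (A + (x : ℂ) • C) *ᵥ y = (α + x * β) • p := by
    intro x
    rw [add_mulVec, smul_mulVec, hAy, hCy, smul_smul, add_smul]
  have hHs : ∀ x : ℝ, (A + (x : ℂ) • C)ᴴ = A + (x : ℂ) • C := by
    intro x
    simp [hA, hC]
  have hγ := eventually_cofinite_add_mul_ne_zero hαβ
  by_cases hσ : star p ⬝ᵥ y = 0
  · obtain ⟨P, hPs, hPp, hPy, hP⟩ := exists_compression_eq hp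
    have hdrop : ∀ᶠ x : ℝ in Filter.cofinite, (P * A * P + (x : ℂ) • (P * C * P)).rank + 2 ≤ r := by
      filter_upwards [hrank, hγ] with x hx hx0
      have e : P * A * P + (x : ℂ) • (P * C * P) = P * ((A + (x : ℂ) • C) * P) := by
        simp [Matrix.mul_add, Matrix.add_mul, Matrix.mul_assoc]
      have hz : (A + (x : ℂ) • C) *ᵥ ((α + x * β)⁻¹ • y) = p := by
        rw [mulVec_smul, hH, smul_smul, inv_mul_cancel₀ hx0, one_smul]
      have h1 := rank_mul_lt_of_mulVec_eq_zero P (A + (x : ℂ) • C) hp hPp hz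
      have h2 := rank_mul_lt_of_mulVec_eq_zero P ((A + (x : ℂ) • C) * P) hp hPp
        (z := (α + x * β)⁻¹ • y) (by rw [← mulVec_mulVec, mulVec_smul P, hPy y hσ, hz])
      rw [← rank_conjTranspose (P * (A + (x : ℂ) • C)), conjTranspose_mul, hPs, hHs] at h1
      rw [e]
      omega
    have h2r : 2 ≤ r := by
      obtain ⟨x, hx⟩ := hdrop.exists
      omega
    have hPs' : ∀ M : Matrix (Fin n) (Fin n) ℂ, Mᴴ = M → (P * M * P)ᴴ = P * M * P := by
      intro M hM
      simp [conjTranspose_mul, hPs, hM, Matrix.mul_assoc]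
    have hrec := ih (r - 2) (by omega) _ _ (hPs' A hA) (hPs' C hC)
      (hdrop.mono fun x hx => by omega)
    obtain ⟨c, hc⟩ := hP A hA
    obtain ⟨d, hd⟩ := hP C hC
    have := hrec.add_rank_two p c d
    rwa [← hc, ← hd, Nat.sub_add_cancel h2r] at this
  · set σ := star p ⬝ᵥ y with hσdef
    have hσ' : star σ ≠ 0 := star_ne_zero.2 hσ
    set q := (star σ)⁻¹ • p with hq
    have hq0 : q ≠ 0 := smul_ne_zero (inv_ne_zero hσ') hp
    have hqy : star q ⬝ᵥ y = 1 := by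
      rw [hq, star_smul, smul_dotProduct, ← hσdef, star_inv₀, star_star, smul_eq_mul,
        inv_mul_cancel₀ hσ]
    have hyq : star y ⬝ᵥ q = 1 := by rw [star_dotProduct, hqy, star_one]
    have hpq : p = star σ • q := by rw [hq, smul_smul, mul_inv_cancel₀ hσ', one_smul]
    have hreal : ∀ (M : Matrix (Fin n) (Fin n) ℂ) (δ : ℂ), Mᴴ = M → M *ᵥ y = δ • p →
        ∃ m : ℝ, M *ᵥ y = (m : ℂ) • q := by
      intro M δ hM hMy
      obtain ⟨m, hm⟩ := exists_ofReal_eq_star_dotProduct_mulVec hM y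
      refine ⟨m, ?_⟩
      rw [← hm, hMy, hpq, smul_smul, dotProduct_smul, hyq, smul_eq_mul, mul_one]
    obtain ⟨a, ha⟩ := hreal A α hA hAy
    obtain ⟨b, hb⟩ := hreal C β hC hCy
    have hQq : (1 - vecMulVec q (star y)) *ᵥ q = 0 := by
      simp [sub_mulVec, vecMulVec_mulVec, hyq]
    have hQ : ∀ (M : Matrix (Fin n) (Fin n) ℂ) (m : ℝ), Mᴴ = M → M *ᵥ y = (m : ℂ) • q →
        (1 - vecMulVec q (star y)) * M = M - (m : ℂ) • vecMulVec q (star q) := by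
      intro M m hM hMy
      have : star y ᵥ* M = (m : ℂ) • star q := by
        rw [← hM, ← star_mulVec, hMy, star_smul]
        simp
      rw [Matrix.sub_mul, Matrix.one_mul, vecMulVec_mul, this, vecMulVec_smul]
    set A' := A - (a : ℂ) • vecMulVec q (star q) with hA'
    set C' := C - (b : ℂ) • vecMulVec q (star q) with hC'
    have hdrop : ∀ᶠ x : ℝ in Filter.cofinite, (A' + (x : ℂ) • C').rank + 1 ≤ r := by
      filter_upwards [hrank, hγ] with x hx hx0
      have e : A' + (x : ℂ) • C' = (1 - vecMulVec q (star y)) * (A + (x : ℂ) • C) := by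
        rw [Matrix.mul_add, Matrix.mul_smul, hQ A a hA ha, hQ C b hC hb]
      have h1 := rank_mul_lt_of_mulVec_eq_zero _ (A + (x : ℂ) • C) hq0 hQq
        (z := (star σ)⁻¹ • (α + x * β)⁻¹ • y)
        (by rw [mulVec_smul, mulVec_smul, hH, smul_smul (α + x * β)⁻¹, inv_mul_cancel₀ hx0, one_smul])
      rw [e]
      omega
    have h1r : 1 ≤ r := by
      obtain ⟨x, hx⟩ := hdrop.exists
      omega
    have hrec := ih (r - 1) (by omega) A' C'
      (by simp [hA', hA, conjTranspose_vecMulVec]) (by simp [hC', hC, conjTranspose_vecMulVec])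
      (hdrop.mono fun x hx => by omega)
    have := hrec.add_rank_one a b q
    rwa [hA', hC', add_sub_cancel, add_sub_cancel, Nat.sub_add_cancel h1r] at this

/-- **Rank-1 decomposition for *-even pencils.**
If `E(λ) = A + λB` is an `n × n` *-even matrix pencil (`Aᴴ = A`, `Bᴴ = -B`) of rank
`r ≤ n`, then there exist `ℓ, s` with `ℓ + 2s = r`, real numbers `a_i, b_i`, vectors
`u_i, v_j ∈ ℂ^n`, and vector pencils `w_j(λ) = c_j + λ d_j` of degree at most one
such that `A + λB = Σ (a_i + λ 𝕚 b_i) u_i u_i^* + Σ (v_j w_j(λ)^* + w_j(−λ) v_j^*)`. -/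
theorem star_even_rank_one_decomposition
    (n r : ℕ) (hrn : r ≤ n) (A B : Matrix (Fin n) (Fin n) ℂ)
    (hA : Aᴴ = A) (hB : Bᴴ = -B)
    (hrank : PencilRankEq n A B r) :
    ∃ (ℓ s : ℕ), ℓ + 2 * s = r ∧
      ∃ (a b : Fin ℓ → ℝ) (u : Fin ℓ → Fin n → ℂ)
        (v c d : Fin s → Fin n → ℂ),
        ∀ lam : ℂ,
          A + lam • B =
            (∑ i : Fin ℓ,
              ((a i : ℂ) + lam * (Complex.I * (b i : ℂ))) • vecMulVec (u i) (star (u i)))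
            + ∑ j : Fin s,
                (vecMulVec (v j) (star (c j) + lam • star (d j))
                  + vecMulVec (c j - lam • d j) (star (v j))) := by
  have hC : ((-Complex.I) • B)ᴴ = (-Complex.I) • B := by
    simp [conjTranspose_smul, hB]
  obtain ⟨ℓ, s, hr, a, b, u, v, c, d, hAeq, hCeq⟩ :=
    hasHermitianPencilDecomposition_of_rank_le r A ((-Complex.I) • B) hA hC
      (Filter.Eventually.of_forall fun x => by
        rw [smul_smul]
        exact hrank.2 _)
  refine ⟨ℓ, s, hr, a, b, u, v, c, fun j => (-Complex.I) • d j, fun lam => ?_⟩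
  have hBeq : B = Complex.I • ((-Complex.I) • B) := by simp [smul_smul]
  rw [hBeq, hCeq, hAeq]
  simp only [add_smul, mul_smul, smul_add, Finset.smul_sum, Finset.sum_add_distrib, vecMulVec_add,
    add_vecMulVec, vecMulVec_smul, smul_vecMulVec, star_smul, star_neg, Complex.star_def,
    Complex.conj_I, neg_neg, neg_smul, smul_neg, sub_neg_eq_add]
  abel
end
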